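/- arXiv:2402.09698 — 2 statements merged into one kernel-verified Lean document; each statement's English description precedes it below -/
import Mathlib

section
/- If a nonnegative martingale converges to zero almost surely, its running maximum has infinite expectation. Let P be a probability measure, F = (F_t)_{t≥0} a filtration, and (M_t)_{t≥0} a nonnegative martingale under P with respect to F with E_P[M_0] = 1. If M_t → 0 P-almost surely as t → ∞, then E_P[sup_{t≥0} M_t] = ∞; in particular, lim_{t→∞} E_P[max_{i≤t} M_i] = ∞. -/
open MeasureTheory Filter Set
open scoped ENNReal NNReal

namespace SAVI

variable {Ω : Type*}

/-- A stopping time with values in `ℕ ∪ {∞}` with respect to the filtration `G`: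
`{τ ≤ t}` is `G t`-measurable for every `t : ℕ`. -/
def IsEStop [mΩ : MeasurableSpace Ω] (G : Filtration ℕ mΩ) (τ : Ω → WithTop ℕ) : Prop :=
  ∀ t : ℕ, MeasurableSet[G t] {ω | τ ω ≤ (t : WithTop ℕ)}

/-- The value of an `ℝ≥0∞`-valued process at an extended stopping time,
interpreted as `limsup_t e t` on the event `{τ = ∞}`. -/
noncomputable def stopVal (e : ℕ → Ω → ℝ≥0∞) (τ : Ω → WithTop ℕ) (ω : Ω) : ℝ≥0∞ :=
  if h : τ ω = ⊤ then Filter.limsup (fun t => e t ω) Filter.atTop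
  else e ((τ ω).untop h) ω

/-- The running maximum `e_t^* = max_{i ≤ t} e_i` of an `ℝ≥0∞`-valued process. -/
noncomputable def runMax (e : ℕ → Ω → ℝ≥0∞) (t : ℕ) (ω : Ω) : ℝ≥0∞ :=
  (Finset.range (t + 1)).sup fun i => e i ω

/-- The event `ξ_τ` obtained by stopping an adapted sequence of events `ξ` at an extended
stopping time `τ`, with `ξ_∞ = limsup_t ξ_t` on `{τ = ∞}`. -/
def stopEventSet (ξ : ℕ → Set Ω) (τ : Ω → WithTop ℕ) : Set Ω :=
  {ω | (∃ t : ℕ, τ ω = (t : WithTop ℕ) ∧ ω ∈ ξ t) ∨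
    (τ ω = ⊤ ∧ ω ∈ Filter.limsup ξ Filter.atTop)}

/-- The event `{p_τ ≤ α}` for a `[0,1]`-valued process `p` stopped at `τ`, interpreted as
`limsup_t {p_t ≤ α}` on `{τ = ∞}`. -/
def stopEventP (p : ℕ → Ω → ℝ) (τ : Ω → WithTop ℕ) (α : ℝ) : Set Ω :=
  {ω | (∃ t : ℕ, τ ω = (t : WithTop ℕ) ∧ p t ω ≤ α) ∨
    (τ ω = ⊤ ∧ ω ∈ Filter.limsup (fun t => {ω' | p t ω' ≤ α}) Filter.atTop)}

/-- An e-process for the family `𝒩` (composite null) in the filtration `G`: a `G`-adapted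
`[0,∞]`-valued process with `e_0 ≤ 1` and `E_P[e_τ] ≤ 1` for every `G`-stopping time `τ`
and every `P ∈ 𝒩`. -/
def IsEProcess [mΩ : MeasurableSpace Ω] (G : Filtration ℕ mΩ) (𝒩 : Set (Measure Ω))
    (e : ℕ → Ω → ℝ≥0∞) : Prop :=
  (∀ t, Measurable[G t] (e t)) ∧ (∀ ω, e 0 ω ≤ 1) ∧
    ∀ τ : Ω → WithTop ℕ, IsEStop G τ → ∀ P ∈ 𝒩, ∫⁻ ω, stopVal e τ ω ∂P ≤ 1

/-- A p-process for the family `𝒩` in the filtration `G`: a `G`-adapted `[0,1]`-valued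
process with `P(p_τ ≤ α) ≤ α` for every `G`-stopping time `τ`, `P ∈ 𝒩`, `α ∈ (0,1)`. -/
def IsPProcess [mΩ : MeasurableSpace Ω] (G : Filtration ℕ mΩ) (𝒩 : Set (Measure Ω))
    (p : ℕ → Ω → ℝ) : Prop :=
  (∀ t, Measurable[G t] (p t)) ∧ (∀ t ω, p t ω ∈ Set.Icc (0 : ℝ) 1) ∧
    ∀ τ : Ω → WithTop ℕ, IsEStop G τ → ∀ P ∈ 𝒩, ∀ α ∈ Set.Ioo (0 : ℝ) 1,
      P (stopEventP p τ α) ≤ ENNReal.ofReal α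

/-- An adjuster: an increasing function `A : [1,∞] → [0,∞]` with `∫_1^∞ A(x)/x² dx ≤ 1`. -/
def IsAdjuster (A : ℝ≥0∞ → ℝ≥0∞) : Prop :=
  MonotoneOn A (Set.Ici 1) ∧
    ∫⁻ x in Set.Ioi (1 : ℝ), A (ENNReal.ofReal x) / ENNReal.ofReal x ^ 2 ≤ 1

/-- An admissible adjuster: additionally right-continuous, `A(∞) = ∞`, and the integral is 1. -/
def IsAdmissibleAdjuster (A : ℝ≥0∞ → ℝ≥0∞) : Prop :=
  IsAdjuster A ∧ (∀ x ∈ Set.Ici (1 : ℝ≥0∞), ContinuousWithinAt A (Set.Ici x) x) ∧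
    A ⊤ = ⊤ ∧ ∫⁻ x in Set.Ioi (1 : ℝ), A (ENNReal.ofReal x) / ENNReal.ofReal x ^ 2 = 1

/-- A p-to-e calibrator: a decreasing function `C : [0,1] → [0,∞]` with `∫_0^1 C(p) dp ≤ 1`. -/
def IsCalibrator (C : ℝ → ℝ≥0∞) : Prop :=
  AntitoneOn C (Set.Icc 0 1) ∧ ∫⁻ p in Set.Icc (0 : ℝ) 1, C p ≤ 1

/-- The adjusted process `e_0^adj = 1`, `e_t^adj = A(e_t^*)` for `t ≥ 1`. -/
noncomputable def adjProcess (A : ℝ≥0∞ → ℝ≥0∞) (e : ℕ → Ω → ℝ≥0∞) : ℕ → Ω → ℝ≥0∞ :=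
  fun t ω => if t = 0 then 1 else A (runMax e t ω)

/-- A test supermartingale for `P` in `G`: nonnegative, `G`-adapted, `M_0 = 1`, and
`E_P[M_t ∣ G_{t-1}] ≤ M_{t-1}`. -/
def IsTestSupermartingale [mΩ : MeasurableSpace Ω] (G : Filtration ℕ mΩ) (P : Measure Ω)
    (M : ℕ → Ω → ℝ) : Prop :=
  Supermartingale M G P ∧ (∀ t ω, 0 ≤ M t ω) ∧ ∀ ω, M 0 ω = 1

/-- Running maximum of a real-valued process. -/
noncomputable def runMaxR (M : ℕ → Ω → ℝ) (t : ℕ) (ω : Ω) : ℝ :=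
  (Finset.range (t + 1)).sup' (Finset.nonempty_range_iff.mpr t.succ_ne_zero) fun i => M i ω

/-- An e-process for the null `𝒩` is `𝒬`-powerful if `limsup_t e_t = ∞` `Q`-a.s. for every
alternative `Q ∈ 𝒬 \ 𝒩`. -/
def IsQPowerful [mΩ : MeasurableSpace Ω] (𝒩 𝒬 : Set (Measure Ω)) (e : ℕ → Ω → ℝ≥0∞) : Prop :=
  ∀ Q ∈ 𝒬 \ 𝒩, ∀ᵐ ω ∂Q, Filter.limsup (fun t => e t ω) Filter.atTop = ⊤


theorem lintegral_ofReal_eq_of_martingale [mΩ : MeasurableSpace Ω] {P : Measure Ω}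
    [IsFiniteMeasure P] {F : Filtration ℕ mΩ} {M : ℕ → Ω → ℝ} (hM : Martingale M F P)
    (hMnn : ∀ t ω, 0 ≤ M t ω) (t : ℕ) :
    ∫⁻ ω, ENNReal.ofReal (M t ω) ∂P = ENNReal.ofReal (∫ ω, M 0 ω ∂P) := by
  rw [← ofReal_integral_eq_lintegral_ofReal (hM.integrable t) (ae_of_all _ (hMnn t))]
  have h := hM.setIntegral_eq (Nat.zero_le t) MeasurableSet.univ
  simp only [Measure.restrict_univ] at h
  rw [h]

theorem lintegral_iSup_eq_top_of_tendsto_zero [MeasurableSpace Ω] {P : Measure Ω}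
    {f : ℕ → Ω → ℝ≥0∞} (hf : ∀ t, AEMeasurable (f t) P) {c : ℝ≥0∞} (hc : c ≠ 0)
    (hfc : ∀ t, ∫⁻ ω, f t ω ∂P = c)
    (hlim : ∀ᵐ ω ∂P, Tendsto (fun t => f t ω) atTop (nhds 0)) :
    ∫⁻ ω, ⨆ t, f t ω ∂P = ⊤ := by
  by_contra hfin
  have h := tendsto_lintegral_of_dominated_convergence' (fun ω => ⨆ t, f t ω) hf
    (fun t => ae_of_all _ fun ω => le_iSup (fun t => f t ω) t) hfin hlim
  simp only [hfc, lintegral_zero] at h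
  exact hc (tendsto_nhds_unique tendsto_const_nhds h)

theorem ofReal_runMaxR (M : ℕ → Ω → ℝ) (t : ℕ) (ω : Ω) :
    ENNReal.ofReal (runMaxR M t ω) = partialSups (fun i => ENNReal.ofReal (M i ω)) t := by
  rw [partialSups_eq_sup'_range]
  exact Finset.apply_sup'_eq_sup'_comp _ ENNReal.ofReal
    fun _ _ => ENNReal.ofReal_mono.map_sup _ _

/-- **If a nonnegative martingale converges to zero almost surely, its running maximum has
infinite expectation.** Let `(M_t)` be a nonnegative martingale under `P` with respect to `F`
with `E_P[M_0] = 1`. If `M_t → 0` `P`-a.s., then `E_P[sup_t M_t] = ∞`, and in particular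
`E_P[max_{i≤t} M_i] → ∞` as `t → ∞`. -/
theorem runMax_expectation_infinite_of_tendsto_zero {Ω : Type*} [mΩ : MeasurableSpace Ω]
    (P : Measure Ω) (hP : IsProbabilityMeasure P)
    (F : Filtration ℕ mΩ) (M : ℕ → Ω → ℝ)
    (hM : Martingale M F P) (hMnn : ∀ t ω, 0 ≤ M t ω)
    (hM0 : ∫ ω, M 0 ω ∂P = 1)
    (hto0 : ∀ᵐ ω ∂P, Filter.Tendsto (fun t => M t ω) Filter.atTop (nhds 0)) :
    (∫⁻ ω, ⨆ t, ENNReal.ofReal (M t ω) ∂P = ⊤) ∧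
      Filter.Tendsto (fun t => ∫⁻ ω, ENNReal.ofReal (runMaxR M t ω) ∂P)
        Filter.atTop (nhds ⊤) := by
  have hmeas : ∀ t, Measurable (fun ω => ENNReal.ofReal (M t ω)) := fun t =>
    ((hM.stronglyMeasurable t).mono (F.le t)).measurable.ennreal_ofReal
  have htop : ∫⁻ ω, ⨆ t, ENNReal.ofReal (M t ω) ∂P = ⊤ := by
    refine lintegral_iSup_eq_top_of_tendsto_zero (fun t => (hmeas t).aemeasurable) one_ne_zero (fun t => ?_) ?_
    · rw [lintegral_ofReal_eq_of_martingale hM hMnn t, hM0, ENNReal.ofReal_one]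
    · filter_upwards [hto0] with ω hω
      simpa using ENNReal.tendsto_ofReal hω
  refine ⟨htop, ?_⟩
  rw [← htop]
  simp only [ofReal_runMaxR]
  refine lintegral_tendsto_of_tendsto_of_monotone (fun t => ?_)
    (ae_of_all _ fun ω => (partialSups _).monotone) (ae_of_all _ fun ω => ?_)
  · simp only [partialSups_eq_sup'_range]
    refine Measurable.aemeasurable ?_
    convert Finset.measurable_sup' (Finset.nonempty_range_add_one (n := t)) fun i _ => hmeas i
    rw [Finset.sup'_apply]
  · rw [← iSup_partialSups_eq]
    exact tendsto_atTop_iSup (partialSups _).monotone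

end SAVI
end

section
/- U-lifting lemma for e-processes in a sub-filtration. Let G ⊆ F be filtrations on (Ω, 𝒜), let 𝒫 be a family of probability measures, and let (e_t)_{t≥0} be an e-process for 𝒫 in G. Suppose U is a random variable which, under every P ∈ 𝒫, is uniformly distributed on [0,1] and independent of the σ-algebra generated by ∪_t F_t. Fix α ∈ (0,1). Then for every F-stopping time τ and every P ∈ 𝒫, P( e_τ ≥ U/α ) ≤ α · min( E_P[e_τ], 1 + log(1/α) ). -/
open MeasureTheory Filter Set
open scoped ENNReal NNReal

namespace SAVI

variable {Ω : Type*}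

theorem stopVal_of_eq_coe {e : ℕ → Ω → ℝ≥0∞} {τ : Ω → WithTop ℕ} {ω : Ω} {t : ℕ}
    (h : τ ω = t) : stopVal e τ ω = e t ω := by
  simp only [stopVal, h, WithTop.natCast_ne_top, dite_false]
  rfl

theorem stopVal_of_eq_top {e : ℕ → Ω → ℝ≥0∞} {τ : Ω → WithTop ℕ} {ω : Ω}
    (h : τ ω = ⊤) : stopVal e τ ω = limsup (fun t => e t ω) atTop := by
  simp [stopVal, h]

/-- The stopped value of an adapted process is measurable with respect to the terminal
`σ`-algebra of the filtration. -/
theorem measurable_stopVal [mΩ : MeasurableSpace Ω] {F : Filtration ℕ mΩ}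
    {e : ℕ → Ω → ℝ≥0∞} (he : ∀ t, Measurable[F t] (e t)) {τ : Ω → WithTop ℕ}
    (hτ : IsEStop F τ) : Measurable[⨆ t, F t] (stopVal e τ) := by
  have hle : ∀ t, F t ≤ ⨆ t, (F t : MeasurableSpace Ω) := fun t =>
    le_iSup (fun t => (F t : MeasurableSpace Ω)) t
  let _ : MeasurableSpace Ω := ⨆ t, F t
  have he' : ∀ t, Measurable (e t) := fun t => (he t).mono (hle t) le_rfl
  have hτ' : Measurable τ := by
    have hcoe : ∀ t : ℕ, MeasurableSet (τ ⁻¹' {(t : WithTop ℕ)}) := by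
      intro t
      have h1 : MeasurableSet {ω | τ ω ≤ (t : WithTop ℕ)} := hle t _ (hτ t)
      have h2 : MeasurableSet (⋃ s < t, {ω | τ ω ≤ (s : WithTop ℕ)}) :=
        MeasurableSet.biUnion (to_countable _) fun s _ => hle s _ (hτ s)
      convert h1.diff h2 using 1
      ext ω
      simp only [mem_preimage, mem_singleton_iff, Set.mem_sdiff, mem_ofPred_eq, mem_iUnion,
        not_exists]
      constructor
      · intro h
        rw [h]
        exact ⟨le_rfl, fun s hs => by exact_mod_cast not_le.2 hs⟩
      · rintro ⟨hle_t, hgt⟩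
        obtain ⟨n, hn⟩ := WithTop.ne_top_iff_exists.1
          (ne_top_of_le_ne_top (WithTop.natCast_ne_top t) hle_t)
        have hn : (n : WithTop ℕ) = τ ω := hn
        rw [← hn] at hle_t ⊢
        have hnt : n ≤ t := by exact_mod_cast hle_t
        rcases hnt.eq_or_lt with rfl | hlt
        · rfl
        · exact absurd hn.ge (hgt n hlt)
    refine measurable_to_countable' fun x => ?_
    cases x with
    | coe n => exact hcoe n
    | top =>
      convert (MeasurableSet.iUnion hcoe).compl using 1
      ext ω
      cases h : τ ω <;> simp [h]
  have hrep : ∀ s : Set ℝ≥0∞, stopVal e τ ⁻¹' s =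
      (⋃ t : ℕ, τ ⁻¹' {(t : WithTop ℕ)} ∩ e t ⁻¹' s) ∪
        (τ ⁻¹' {⊤} ∩ (fun ω => limsup (fun t => e t ω) atTop) ⁻¹' s) := by
    intro s
    ext ω
    cases h : τ ω with
    | top => simp [h, stopVal_of_eq_top h]
    | coe n => simp [h, stopVal_of_eq_coe h]
  intro s hs
  rw [hrep]
  exact (MeasurableSet.iUnion fun t => (hτ' (measurableSet_singleton _)).inter (he' t hs)).union
    ((hτ' (measurableSet_singleton _)).inter (Measurable.limsup he' hs))

open Classical in
/-- The first time at which the process `e` reaches the level `c`. -/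
noncomputable def firstReach (e : ℕ → Ω → ℝ≥0∞) (c : ℝ≥0∞) (ω : Ω) : WithTop ℕ :=
  if h : ∃ t, c ≤ e t ω then (Nat.find h : WithTop ℕ) else ⊤

theorem firstReach_le_iff {e : ℕ → Ω → ℝ≥0∞} {c : ℝ≥0∞} {ω : Ω} {t : ℕ} :
    firstReach e c ω ≤ t ↔ ∃ s ≤ t, c ≤ e s ω := by
  classical
  unfold firstReach
  split_ifs with h
  · rw [← Nat.find_le_iff h]
    exact_mod_cast Iff.rfl
  · push Not at h
    simp only [top_le_iff, WithTop.natCast_ne_top, false_iff]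
    rintro ⟨s, -, hs⟩
    exact (h s).not_ge hs

theorem isEStop_firstReach [mΩ : MeasurableSpace Ω] {G : Filtration ℕ mΩ}
    {e : ℕ → Ω → ℝ≥0∞} (he : ∀ t, Measurable[G t] (e t)) (c : ℝ≥0∞) :
    IsEStop G (firstReach e c) := by
  intro t
  have : {ω | firstReach e c ω ≤ (t : WithTop ℕ)} = ⋃ s ≤ t, e s ⁻¹' Ici c := by
    ext ω
    simp [firstReach_le_iff]
  rw [this]
  exact MeasurableSet.biUnion (to_countable _) fun s hs => G.mono hs _ (he s measurableSet_Ici)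

/-- If `e` stopped at any time is at least `c`, then so is `e` stopped on reaching `c`. -/
theorem le_stopVal_firstReach {e : ℕ → Ω → ℝ≥0∞} {c : ℝ≥0∞} {τ : Ω → WithTop ℕ} {ω : Ω}
    (h : c ≤ stopVal e τ ω) : c ≤ stopVal e (firstReach e c) ω := by
  classical
  by_cases hc : ∃ t, c ≤ e t ω
  · rw [stopVal_of_eq_coe (t := Nat.find hc) (by simp [firstReach, hc])]
    exact Nat.find_spec hc
  · rw [stopVal_of_eq_top (by simp [firstReach, hc])]
    cases hτ : τ ω with
    | top => rwa [stopVal_of_eq_top hτ] at h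
    | coe n => exact absurd ⟨n, by rwa [stopVal_of_eq_coe hτ] at h⟩ hc

/-- Ville's inequality for e-processes, at an arbitrary random time. -/
theorem IsEProcess.measure_le_stopVal_le [mΩ : MeasurableSpace Ω] {G : Filtration ℕ mΩ}
    {𝒩 : Set (Measure Ω)} {e : ℕ → Ω → ℝ≥0∞} (he : IsEProcess G 𝒩 e) {P : Measure Ω}
    (hP : P ∈ 𝒩) (τ : Ω → WithTop ℕ) {c : ℝ≥0∞} (hc : c ≠ 0) (hc' : c ≠ ⊤) :
    P {ω | c ≤ stopVal e τ ω} ≤ c⁻¹ := by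
  have hσ := isEStop_firstReach he.1 c
  have hmeas : Measurable (stopVal e (firstReach e c)) :=
    (measurable_stopVal he.1 hσ).mono (iSup_le G.le) le_rfl
  calc P {ω | c ≤ stopVal e τ ω} ≤ P {ω | c ≤ stopVal e (firstReach e c) ω} :=
        measure_mono fun ω hω => le_stopVal_firstReach hω
    _ ≤ (∫⁻ ω, stopVal e (firstReach e c) ω ∂P) / c :=
        meas_ge_le_lintegral_div hmeas.aemeasurable hc hc'
    _ ≤ 1 / c := ENNReal.div_le_div_right (he.2.2 _ hσ P hP) c
    _ = c⁻¹ := one_div c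

/-- `∫₀¹ f ≤ α (1 + log (1 / α))` whenever `f u ≤ min 1 (α / u)`. -/
theorem setLIntegral_Icc_le_mul_one_add_log {α : ℝ} (hα : α ∈ Ioo (0 : ℝ) 1)
    {f : ℝ → ℝ≥0∞} (hf1 : ∀ u, f u ≤ 1)
    (hf : ∀ u, 0 < u → f u ≤ ENNReal.ofReal (α / u)) :
    ∫⁻ u in Icc (0 : ℝ) 1, f u ≤
      ENNReal.ofReal α * ENNReal.ofReal (1 + Real.log (1 / α)) := by
  obtain ⟨h0, h1⟩ := hα
  have hlog : 0 ≤ Real.log (1 / α) := Real.log_nonneg (by rw [le_div_iff₀ h0]; linarith)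
  have hleft : ∫⁻ u in Icc 0 α, f u ≤ ENNReal.ofReal α := by
    calc ∫⁻ u in Icc 0 α, f u ≤ ∫⁻ _ in Icc 0 α, 1 := lintegral_mono hf1
      _ = ENNReal.ofReal α := by simp
  have hint : IntervalIntegrable (fun u : ℝ => α / u) volume α 1 := by
    refine ContinuousOn.intervalIntegrable fun u hu => ?_
    rw [uIcc_of_le h1.le] at hu
    exact (continuousAt_const.div continuousAt_id (h0.trans_le hu.1).ne').continuousWithinAt
  have hright : ∫⁻ u in Ioc α 1, f u ≤ ENNReal.ofReal (α * Real.log (1 / α)) := by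
    calc ∫⁻ u in Ioc α 1, f u ≤ ∫⁻ u in Ioc α 1, ENNReal.ofReal (α / u) :=
          setLIntegral_mono' measurableSet_Ioc fun u hu => hf u (h0.trans hu.1)
      _ = ENNReal.ofReal (∫ u in Ioc α 1, α / u) := by
          rw [ofReal_integral_eq_lintegral_ofReal hint.1]
          exact (ae_restrict_mem measurableSet_Ioc).mono fun u hu =>
            (div_pos h0 (h0.trans hu.1)).le
      _ = ENNReal.ofReal (α * Real.log (1 / α)) := by
          rw [← intervalIntegral.integral_of_le h1.le]
          simp only [div_eq_mul_inv α]
          rw [intervalIntegral.integral_const_mul, integral_inv_of_pos h0 one_pos]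
  rw [← Icc_union_Ioc_eq_Icc h0.le h1.le]
  calc _ ≤ _ := lintegral_union_le _ _ _
    _ ≤ _ := add_le_add hleft hright
    _ = _ := by
      rw [← ENNReal.ofReal_add h0.le (by positivity), ← ENNReal.ofReal_mul h0.le]
      ring_nf

/-- The event that a uniform variable `U` is at most `α X` for an independent `X`, expressed in
terms of the joint law. -/
theorem measure_div_le_eq_prod [mΩ : MeasurableSpace Ω] {P : Measure Ω}
    [IsProbabilityMeasure P] {U : Ω → ℝ} (hU : Measurable U) {X : Ω → ℝ≥0∞} (hX : Measurable X)
    (hunif : P.map U = (volume : Measure ℝ).restrict (Icc 0 1))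
    (hindep : ProbabilityTheory.IndepFun U X P) (α : ℝ) :
    P {ω | ENNReal.ofReal (U ω) / ENNReal.ofReal α ≤ X ω} =
      (((volume : Measure ℝ).restrict (Icc 0 1)).prod (P.map X))
        {p | ENNReal.ofReal p.1 / ENNReal.ofReal α ≤ p.2} := by
  have hS : MeasurableSet {p : ℝ × ℝ≥0∞ | ENNReal.ofReal p.1 / ENNReal.ofReal α ≤ p.2} :=
    measurableSet_le (by fun_prop) (by fun_prop)
  rw [← hunif, ← (ProbabilityTheory.indepFun_iff_map_prod_eq_prod_map_map hU.aemeasurable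
    hX.aemeasurable).1 hindep, Measure.map_apply (hU.prodMk hX) hS]
  rfl

theorem volume_restrict_div_le {α : ℝ} (hα : 0 < α) (x : ℝ≥0∞) :
    (volume : Measure ℝ).restrict (Icc 0 1) {u | ENNReal.ofReal u / ENNReal.ofReal α ≤ x} ≤
      ENNReal.ofReal α * x := by
  have hα0 : ENNReal.ofReal α ≠ 0 := by simpa using hα
  rcases eq_or_ne x ⊤ with rfl | hx
  · simp [ENNReal.mul_top hα0]
  rw [Measure.restrict_apply' measurableSet_Icc]
  have hfin : ENNReal.ofReal α * x ≠ ⊤ := ENNReal.mul_ne_top ENNReal.ofReal_ne_top hx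
  calc _ ≤ volume (Icc 0 (ENNReal.ofReal α * x).toReal) := by
        refine measure_mono fun u ⟨hu, hu'⟩ => ⟨hu'.1, ?_⟩
        rw [mem_ofPred_eq, ENNReal.div_le_iff hα0 ENNReal.ofReal_ne_top, mul_comm] at hu
        exact (ENNReal.ofReal_le_iff_le_toReal hfin).1 hu
    _ = ENNReal.ofReal α * x := by rw [Real.volume_Icc, sub_zero, ENNReal.ofReal_toReal hfin]

/-- **U-lifting lemma for e-processes in a sub-filtration.** Let `(e_t)` be an e-process for
`𝒩` in the sub-filtration `G ⊆ F`, and let `U` be a random variable which under every `P ∈ 𝒩`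
is uniform on `[0,1]` and independent of `σ(∪_t F_t)`. Fix `α ∈ (0,1)`. Then for every
`F`-stopping time `τ` and every `P ∈ 𝒩`,
`P(e_τ ≥ U/α) ≤ α · min(E_P[e_τ], 1 + log(1/α))`. -/
theorem u_lifting_lemma {Ω : Type*} [mΩ : MeasurableSpace Ω]
    (F G : Filtration ℕ mΩ) (hGF : ∀ t, G t ≤ F t) (hF0 : F 0 = ⊥) (hG0 : G 0 = ⊥)
    (𝒩 : Set (Measure Ω)) (h𝒩 : ∀ P ∈ 𝒩, IsProbabilityMeasure P)
    (e : ℕ → Ω → ℝ≥0∞) (he : IsEProcess G 𝒩 e)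
    (U : Ω → ℝ) (hU : Measurable U)
    (hUunif : ∀ P ∈ 𝒩, Measure.map U P = (volume : Measure ℝ).restrict (Set.Icc 0 1))
    (hUindep : ∀ P ∈ 𝒩, ProbabilityTheory.Indep
      (MeasurableSpace.comap U inferInstance) (⨆ t, (F t : MeasurableSpace Ω)) P)
    (α : ℝ) (hα : α ∈ Set.Ioo (0 : ℝ) 1) :
    ∀ τ : Ω → WithTop ℕ, IsEStop F τ → ∀ P ∈ 𝒩,
      P {ω | ENNReal.ofReal (U ω) / ENNReal.ofReal α ≤ stopVal e τ ω}
        ≤ ENNReal.ofReal α *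
            min (∫⁻ ω, stopVal e τ ω ∂P) (ENNReal.ofReal (1 + Real.log (1 / α))) := by
  intro τ hτ P hP
  have := h𝒩 P hP
  have hXF : Measurable[⨆ t, F t] (stopVal e τ) :=
    measurable_stopVal (fun t => (he.1 t).mono (hGF t) le_rfl) hτ
  have hX : Measurable (stopVal e τ) := hXF.mono (iSup_le F.le) le_rfl
  have hindep : ProbabilityTheory.IndepFun U (stopVal e τ) P :=
    (ProbabilityTheory.IndepFun_iff_Indep _ _ _).2
      (ProbabilityTheory.indep_of_indep_of_le_right (hUindep P hP) hXF.comap_le)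
  have hα0 : ENNReal.ofReal α ≠ 0 := by simpa using hα.1
  have hS : MeasurableSet {p : ℝ × ℝ≥0∞ | ENNReal.ofReal p.1 / ENNReal.ofReal α ≤ p.2} :=
    measurableSet_le (by fun_prop) (by fun_prop)
  have := Measure.isProbabilityMeasure_map (μ := P) hX.aemeasurable
  rw [measure_div_le_eq_prod hU hX (hUunif P hP) hindep]
  rcases min_choice (∫⁻ ω, stopVal e τ ω ∂P) (ENNReal.ofReal (1 + Real.log (1 / α)))
    with h | h <;> rw [h]
  · rw [Measure.prod_apply_symm hS, lintegral_map (measurable_measure_prodMk_right hS) hX,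
      ← lintegral_const_mul _ hX]
    exact lintegral_mono fun ω => volume_restrict_div_le hα.1 _
  · rw [Measure.prod_apply hS]
    refine setLIntegral_Icc_le_mul_one_add_log hα (fun u => prob_le_one) fun u hu => ?_
    have hu0 : ENNReal.ofReal u ≠ 0 := by simpa using hu
    rw [Measure.map_apply hX (measurable_prodMk_left hS), ENNReal.ofReal_div_of_pos hu,
      ← ENNReal.inv_div (Or.inl ENNReal.ofReal_ne_top) (Or.inl hα0)]
    exact he.measure_le_stopVal_le hP τ (ENNReal.div_pos hu0 ENNReal.ofReal_ne_top).ne'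
      (ENNReal.div_ne_top ENNReal.ofReal_ne_top hα0)

end SAVI
end
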